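/- Let 𝔼 = ⟨ℰ, B⟩ be an epistemic space and ∘ an extended credibility-limited revision operator for 𝔼. For each Ψ ∈ ℰ define C_Ψ = {ω ∈ Ω : ⟦Ψ∘φ_ω⟧ = {ω}} and define, for ω₁, ω₂ ∈ C_Ψ, ω₁ ⪯_Ψ ω₂ iff ω₁ ∈ ⟦Ψ∘φ_{ω₁,ω₂}⟧. Then for every Ψ ∈ ℰ and every formula α with ⟦α⟧ ∩ C_Ψ ≠ ∅, it holds that ⟦Ψ∘α⟧ = min(⟦α⟧, ⪯_Ψ), where min(X,⪯_Ψ) = {ω ∈ X : ω ⪯_Ψ ω' for all ω' ∈ X}. -/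

import Mathlib

namespace CLR

/-- Propositional formulas over a signature `V` (with falsum `⊥` and implication;
other connectives are defined). -/
inductive Form (V : Type) : Type
  | atom : V → Form V
  | fls  : Form V
  | imp  : Form V → Form V → Form V

namespace Form

variable {V : Type}

/-- Negation `¬φ := φ → ⊥`. -/
def neg (φ : Form V) : Form V := Form.imp φ Form.fls

/-- Verum `⊤ := ¬⊥`. -/
def tru : Form V := neg (Form.fls : Form V)

/-- Disjunction `φ ∨ ψ := ¬φ → ψ`. -/
def or' (φ ψ : Form V) : Form V := Form.imp (neg φ) ψ

/-- Conjunction `φ ∧ ψ := ¬(¬φ ∨ ¬ψ)`. -/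
def and' (φ ψ : Form V) : Form V := neg (or' (neg φ) (neg ψ))

/-- Evaluation of a formula in an interpretation `w : V → Bool`. -/
def eval (w : V → Bool) : Form V → Bool
  | atom v => w v
  | fls => false
  | imp φ ψ => !(eval w φ) || eval w ψ

end Form

/-- Interpretations (possible worlds) over signature `V`. -/
abbrev World (V : Type) := V → Bool

/-- The set of models `⟦φ⟧` of a formula. -/
def mods {V : Type} (φ : Form V) : Set (World V) := {w | φ.eval w = true}

/-- The set of models `⟦X⟧` of a set of formulas. -/
def modsSet {V : Type} (X : Set (Form V)) : Set (World V) :=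
  {w | ∀ φ ∈ X, φ.eval w = true}

/-- Deductive closure (via semantic entailment, which is adequate for
classical propositional logic). -/
def Cn {V : Type} (X : Set (Form V)) : Set (Form V) :=
  {φ | ∀ w ∈ modsSet X, w ∈ mods φ}

/-- Expansion: `X + α` is the deductive closure of `X ∪ {α}`. -/
def plus {V : Type} (X : Set (Form V)) (α : Form V) : Set (Form V) :=
  Cn (X ∪ {α})

/-- A formula is consistent if it has a model. -/
def FormConsistent {V : Type} (φ : Form V) : Prop := (mods φ).Nonempty

/-- A set of formulas is consistent if it has a model. -/
def SetConsistent {V : Type} (X : Set (Form V)) : Prop := (modsSet X).Nonempty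

/-- An epistemic space `𝔼 = ⟨ℰ, B⟩`: each epistemic state `Ψ : E` has a
deductively closed belief set `B Ψ`. -/
structure EpistemicSpace (V E : Type) where
  B : E → Set (Form V)
  closed : ∀ Ψ, B Ψ = Cn (B Ψ)

variable {V E : Type}

/-- Models `⟦Ψ⟧` of the belief set of an epistemic state. -/
def modsOf (ES : EpistemicSpace V E) (Ψ : E) : Set (World V) := modsSet (ES.B Ψ)

/-- (R1) `α ∈ B(Ψ∘α)`. -/
def R1 (ES : EpistemicSpace V E) (circ : E → Form V → E) : Prop :=
  ∀ Ψ α, α ∈ ES.B (circ Ψ α)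

/-- (R2) `B(Ψ∘α) = B(Ψ)+α` whenever `B(Ψ)+α` is consistent. -/
def R2 (ES : EpistemicSpace V E) (circ : E → Form V → E) : Prop :=
  ∀ Ψ α, SetConsistent (plus (ES.B Ψ) α) → ES.B (circ Ψ α) = plus (ES.B Ψ) α

/-- (R3) if `α` is consistent then `B(Ψ∘α)` is consistent. -/
def R3 (ES : EpistemicSpace V E) (circ : E → Form V → E) : Prop :=
  ∀ Ψ α, FormConsistent α → SetConsistent (ES.B (circ Ψ α))

/-- (R4) if `α ≡ β` then `B(Ψ∘α) = B(Ψ∘β)`. -/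
def R4 (ES : EpistemicSpace V E) (circ : E → Form V → E) : Prop :=
  ∀ Ψ α β, mods α = mods β → ES.B (circ Ψ α) = ES.B (circ Ψ β)

/-- (R5) `B(Ψ∘(α∧β)) ⊆ B(Ψ∘α)+β`. -/
def R5 (ES : EpistemicSpace V E) (circ : E → Form V → E) : Prop :=
  ∀ Ψ α β, ES.B (circ Ψ (Form.and' α β)) ⊆ plus (ES.B (circ Ψ α)) β

/-- (R6) if `B(Ψ∘α)+β` is consistent then `B(Ψ∘α)+β ⊆ B(Ψ∘(α∧β))`. -/
def R6 (ES : EpistemicSpace V E) (circ : E → Form V → E) : Prop :=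
  ∀ Ψ α β, SetConsistent (plus (ES.B (circ Ψ α)) β) →
    plus (ES.B (circ Ψ α)) β ⊆ ES.B (circ Ψ (Form.and' α β))

/-- AGM revision operator: satisfies (R1)–(R6). -/
def AGMRev (ES : EpistemicSpace V E) (circ : E → Form V → E) : Prop :=
  R1 ES circ ∧ R2 ES circ ∧ R3 ES circ ∧ R4 ES circ ∧ R5 ES circ ∧ R6 ES circ

/-- (CL1) `α ∈ B(Ψ∘α)` or `B(Ψ∘α) = B(Ψ)`. -/
def CL1 (ES : EpistemicSpace V E) (circ : E → Form V → E) : Prop :=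
  ∀ Ψ α, α ∈ ES.B (circ Ψ α) ∨ ES.B (circ Ψ α) = ES.B Ψ

/-- (CL2) `B(Ψ∘α) = B(Ψ)+α` whenever `B(Ψ)+α` is consistent. -/
def CL2 (ES : EpistemicSpace V E) (circ : E → Form V → E) : Prop :=
  ∀ Ψ α, SetConsistent (plus (ES.B Ψ) α) → ES.B (circ Ψ α) = plus (ES.B Ψ) α

/-- (CL3) `B(Ψ∘α)` is consistent. -/
def CL3 (ES : EpistemicSpace V E) (circ : E → Form V → E) : Prop :=
  ∀ Ψ α, SetConsistent (ES.B (circ Ψ α))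

/-- (CL4) if `α ≡ β` then `B(Ψ∘α) = B(Ψ∘β)`. -/
def CL4 (ES : EpistemicSpace V E) (circ : E → Form V → E) : Prop :=
  ∀ Ψ α β, mods α = mods β → ES.B (circ Ψ α) = ES.B (circ Ψ β)

/-- (CL5) if `α ∈ B(Ψ∘α)` and `α ⊨ β` then `β ∈ B(Ψ∘β)`. -/
def CL5 (ES : EpistemicSpace V E) (circ : E → Form V → E) : Prop :=
  ∀ Ψ α β, α ∈ ES.B (circ Ψ α) → mods α ⊆ mods β → β ∈ ES.B (circ Ψ β)

/-- (CL6) `B(Ψ∘(α∨β))` equals `B(Ψ∘α)`, or `B(Ψ∘β)`, or `B(Ψ∘α) ∩ B(Ψ∘β)`. -/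
def CL6 (ES : EpistemicSpace V E) (circ : E → Form V → E) : Prop :=
  ∀ Ψ α β,
    ES.B (circ Ψ (Form.or' α β)) = ES.B (circ Ψ α) ∨
    ES.B (circ Ψ (Form.or' α β)) = ES.B (circ Ψ β) ∨
    ES.B (circ Ψ (Form.or' α β)) = ES.B (circ Ψ α) ∩ ES.B (circ Ψ β)

/-- Credibility-limited revision operator: satisfies (CL1)–(CL6). -/
def CLRev (ES : EpistemicSpace V E) (circ : E → Form V → E) : Prop :=
  CL1 ES circ ∧ CL2 ES circ ∧ CL3 ES circ ∧ CL4 ES circ ∧ CL5 ES circ ∧ CL6 ES circ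

/-- (ECL1) = (CL1). -/
def ECL1 (ES : EpistemicSpace V E) (circ : E → Form V → E) : Prop :=
  ∀ Ψ α, α ∈ ES.B (circ Ψ α) ∨ ES.B (circ Ψ α) = ES.B Ψ

/-- (ECL2) = (CL2). -/
def ECL2 (ES : EpistemicSpace V E) (circ : E → Form V → E) : Prop :=
  ∀ Ψ α, SetConsistent (plus (ES.B Ψ) α) → ES.B (circ Ψ α) = plus (ES.B Ψ) α

/-- (ECL3) if `B(Ψ∘α)` is inconsistent then `B(Ψ)` or `α` is inconsistent. -/
def ECL3 (ES : EpistemicSpace V E) (circ : E → Form V → E) : Prop :=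
  ∀ Ψ α, ¬ SetConsistent (ES.B (circ Ψ α)) →
    ¬ SetConsistent (ES.B Ψ) ∨ ¬ FormConsistent α

/-- (ECL4) if `B(Ψ∘α)` is consistent and `α ⊨ β` then `B(Ψ∘β)` is consistent. -/
def ECL4 (ES : EpistemicSpace V E) (circ : E → Form V → E) : Prop :=
  ∀ Ψ α β, SetConsistent (ES.B (circ Ψ α)) → mods α ⊆ mods β →
    SetConsistent (ES.B (circ Ψ β))

/-- (ECL5) = (CL4). -/
def ECL5 (ES : EpistemicSpace V E) (circ : E → Form V → E) : Prop :=
  ∀ Ψ α β, mods α = mods β → ES.B (circ Ψ α) = ES.B (circ Ψ β)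

/-- (ECL6) = (CL5). -/
def ECL6 (ES : EpistemicSpace V E) (circ : E → Form V → E) : Prop :=
  ∀ Ψ α β, α ∈ ES.B (circ Ψ α) → mods α ⊆ mods β → β ∈ ES.B (circ Ψ β)

/-- (ECL7) = (CL6). -/
def ECL7 (ES : EpistemicSpace V E) (circ : E → Form V → E) : Prop :=
  ∀ Ψ α β,
    ES.B (circ Ψ (Form.or' α β)) = ES.B (circ Ψ α) ∨
    ES.B (circ Ψ (Form.or' α β)) = ES.B (circ Ψ β) ∨
    ES.B (circ Ψ (Form.or' α β)) = ES.B (circ Ψ α) ∩ ES.B (circ Ψ β)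

/-- Extended credibility-limited revision operator: satisfies (ECL1)–(ECL7). -/
def ECLRev (ES : EpistemicSpace V E) (circ : E → Form V → E) : Prop :=
  ECL1 ES circ ∧ ECL2 ES circ ∧ ECL3 ES circ ∧ ECL4 ES circ ∧
    ECL5 ES circ ∧ ECL6 ES circ ∧ ECL7 ES circ

/-- `min(X,⪯) = {ω ∈ X : ω ⪯ ω' for all ω' ∈ X}`. -/
def minSet {W : Type} (X : Set W) (le : W → W → Prop) : Set W :=
  {ω ∈ X | ∀ ω' ∈ X, le ω ω'}

/-- The data of a credibility-limited assignment `Ψ ↦ (⪯_Ψ, C_Ψ, b_Ψ)`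
(with `b_Ψ = ⊤` rendered as `true`, `b_Ψ = ⊥` as `false`). -/
structure CLAssignment (V E : Type) where
  le : E → World V → World V → Prop
  C : E → Set (World V)
  b : E → Bool

/-- `A` is a credibility-limited assignment for `ES`: `⟦Ψ⟧ ⊆ C_Ψ`,
`⪯_Ψ` is a total preorder on `C_Ψ`, and (CLA⊥): if `b_Ψ = ⊥` then `C_Ψ = Ω`. -/
def IsCLAssignment (ES : EpistemicSpace V E) (A : CLAssignment V E) : Prop :=
  (∀ Ψ, modsOf ES Ψ ⊆ A.C Ψ) ∧
  (∀ Ψ, ∀ ω₁ ∈ A.C Ψ, ∀ ω₂ ∈ A.C Ψ, A.le Ψ ω₁ ω₂ ∨ A.le Ψ ω₂ ω₁) ∧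
  (∀ Ψ, ∀ ω₁ ∈ A.C Ψ, ∀ ω₂ ∈ A.C Ψ, ∀ ω₃ ∈ A.C Ψ,
      A.le Ψ ω₁ ω₂ → A.le Ψ ω₂ ω₃ → A.le Ψ ω₁ ω₃) ∧
  (∀ Ψ, A.b Ψ = false → A.C Ψ = Set.univ)

/-- Faithfulness: (CLFA1) and (CLFA2). -/
def Faithful (ES : EpistemicSpace V E) (A : CLAssignment V E) : Prop :=
  (∀ (Ψ : E) (ω₁ ω₂ : World V), ω₁ ∈ modsOf ES Ψ → ω₂ ∈ modsOf ES Ψ →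
      A.le Ψ ω₁ ω₂ ∧ A.le Ψ ω₂ ω₁) ∧
  (∀ (Ψ : E) (ω₁ ω₂ : World V), ω₁ ∈ modsOf ES Ψ → ω₂ ∉ modsOf ES Ψ →
      A.le Ψ ω₁ ω₂ ∧ ¬ A.le Ψ ω₂ ω₁)

/-- Revision-compatibility of an assignment with a belief change operator:
`⟦Ψ∘α⟧ = min(⟦α⟧,⪯_Ψ)` if `⟦α⟧ ∩ C_Ψ ≠ ∅`; `⟦Ψ∘α⟧ = ∅` if `⟦α⟧ = ∅` and
`b_Ψ = ⊥`; and `⟦Ψ∘α⟧ = ⟦Ψ⟧` otherwise. -/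
def RevCompatible (ES : EpistemicSpace V E) (circ : E → Form V → E)
    (A : CLAssignment V E) : Prop :=
  ∀ Ψ α,
    ((mods α ∩ A.C Ψ).Nonempty →
      modsOf ES (circ Ψ α) = minSet (mods α) (A.le Ψ)) ∧
    (mods α = ∅ → A.b Ψ = false → modsOf ES (circ Ψ α) = ∅) ∧
    (¬ (mods α ∩ A.C Ψ).Nonempty → ¬ (mods α = ∅ ∧ A.b Ψ = false) →
      modsOf ES (circ Ψ α) = modsOf ES Ψ)


theorem mods_or' {V : Type} (φ ψ : Form V) : mods (Form.or' φ ψ) = mods φ ∪ mods ψ := by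
  ext w
  simp [mods, Form.or', Form.neg, Form.eval]

theorem mods_and'_neg {V : Type} (φ ψ : Form V) :
    mods (Form.and' φ (Form.neg ψ)) = mods φ \ mods ψ := by
  ext w
  simp [mods, Form.and', Form.or', Form.neg, Form.eval]

theorem modsSet_plus {V : Type} (X : Set (Form V)) (α : Form V) :
    modsSet (plus X α) = modsSet X ∩ mods α := by
  ext w
  constructor
  · intro hw
    exact ⟨fun φ hφ => hw φ fun v hv => hv φ (Or.inl hφ), hw α fun v hv => hv α (Or.inr rfl)⟩
  · rintro ⟨hX, hα⟩ φ hφ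
    refine hφ w ?_
    rintro ψ (hψ | rfl)
    exacts [hX ψ hψ, hα]

theorem mem_belief_iff {V E : Type} (ES : EpistemicSpace V E) (Ψ : E) (α : Form V) :
    α ∈ ES.B Ψ ↔ modsOf ES Ψ ⊆ mods α := by
  rw [ES.closed Ψ]
  rfl

theorem modsSet_belief_inter {V E : Type} (ES : EpistemicSpace V E) (Ψ Φ : E) :
    modsSet (ES.B Ψ ∩ ES.B Φ) = modsOf ES Ψ ∪ modsOf ES Φ := by
  ext w
  constructor
  · intro hw
    by_contra hn
    simp only [Set.mem_union, not_or, modsOf, modsSet, Set.mem_ofPred_eq, not_forall] at hn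
    obtain ⟨⟨φ, hφ, hφw⟩, ψ, hψ, hψw⟩ := hn
    have hor : w ∈ mods (Form.or' φ ψ) := by
      refine hw _ ⟨?_, ?_⟩
      · rw [mem_belief_iff, mods_or']
        exact ((mem_belief_iff ES Ψ φ).1 hφ).trans Set.subset_union_left
      · rw [mem_belief_iff, mods_or']
        exact ((mem_belief_iff ES Φ ψ).1 hψ).trans Set.subset_union_right
    rw [mods_or'] at hor
    exact hor.elim hφw hψw
  · rintro (hw | hw) φ ⟨hφ, hφ'⟩
    exacts [hw φ hφ, hw φ hφ']

namespace ECLRev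

variable {V E : Type} {ES : EpistemicSpace V E} {circ : E → Form V → E}

theorem modsOf_eq_inter (h : ECLRev ES circ) {Ψ : E} {α : Form V}
    (hα : (modsOf ES Ψ ∩ mods α).Nonempty) :
    modsOf ES (circ Ψ α) = modsOf ES Ψ ∩ mods α := by
  obtain ⟨-, h2, -⟩ := h
  have hc : SetConsistent (plus (ES.B Ψ) α) := by
    rwa [SetConsistent, modsSet_plus]
  rw [modsOf, h2 Ψ α hc, modsSet_plus, modsOf]

theorem mem_modsOf_of_notMem (h : ECLRev ES circ) {Ψ : E} {α : Form V} {ω : World V}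
    (hω : ω ∈ modsOf ES (circ Ψ α)) (hα : ω ∉ mods α) : ω ∈ modsOf ES Ψ := by
  rcases h.1 Ψ α with hs | hs
  · exact absurd ((mem_belief_iff ES _ α).1 hs hω) hα
  · rwa [modsOf, hs] at hω

theorem modsOf_trichotomy (h : ECLRev ES circ) (Ψ : E) {α β γ : Form V}
    (hα : mods α = mods β ∪ mods γ) :
    modsOf ES (circ Ψ α) = modsOf ES (circ Ψ β) ∨
      modsOf ES (circ Ψ α) = modsOf ES (circ Ψ γ) ∨
      modsOf ES (circ Ψ α) = modsOf ES (circ Ψ β) ∪ modsOf ES (circ Ψ γ) := by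
  obtain ⟨-, -, -, -, h5, -, h7⟩ := h
  have hor : ES.B (circ Ψ α) = ES.B (circ Ψ (Form.or' β γ)) :=
    h5 Ψ _ _ (hα.trans (mods_or' β γ).symm)
  rw [← modsSet_belief_inter]
  unfold modsOf
  rw [hor]
  exact (h7 Ψ β γ).imp (congrArg modsSet) (Or.imp (congrArg modsSet) (congrArg modsSet))

end ECLRev

/-- For an extended credibility-limited revision operator, with
`C_Ψ = {ω : ⟦Ψ∘φ_ω⟧ = {ω}}` and `ω₁ ⪯_Ψ ω₂ ↔ ω₁ ∈ ⟦Ψ∘φ_{ω₁,ω₂}⟧`: whenever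
`⟦α⟧ ∩ C_Ψ ≠ ∅`, it holds that `⟦Ψ∘α⟧ = min(⟦α⟧, ⪯_Ψ)`. -/
theorem stmt17 {V E : Type} [Nonempty V] [Fintype V] [Nonempty E]
    (ES : EpistemicSpace V E) (circ : E → Form V → E)
    (h : ECLRev ES circ)
    (g : World V → Form V) (hg : ∀ ω : World V, mods (g ω) = {ω})
    (f : World V → World V → Form V)
    (hf : ∀ ω₁ ω₂ : World V, mods (f ω₁ ω₂) = {ω₁, ω₂})
    (Ψ : E) (α : Form V)
    (hne : (mods α ∩ {ω : World V | modsOf ES (circ Ψ (g ω)) = {ω}}).Nonempty) :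
    modsOf ES (circ Ψ α) =
      minSet (mods α) (fun ω₁ ω₂ => ω₁ ∈ modsOf ES (circ Ψ (f ω₁ ω₂))) := by
  have split : ∀ {ω ω' : World V}, ω ∈ mods α → ω' ∈ mods α →
      mods α = mods (f ω ω') ∪ mods (Form.and' α (Form.neg (f ω ω'))) := by
    intro ω ω' hω hω'
    rw [mods_and'_neg, hf, Set.union_sdiff_cancel]
    exact Set.insert_subset hω (Set.singleton_subset_iff.2 hω')
  have outside : ∀ {ω ω' v : World V}, v ∈ mods (f ω ω') →
      v ∈ modsOf ES (circ Ψ (Form.and' α (Form.neg (f ω ω')))) → v ∈ modsOf ES Ψ := by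
    intro ω ω' v hv hvS
    refine h.mem_modsOf_of_notMem hvS ?_
    rw [mods_and'_neg]
    exact fun hn => hn.2 hv
  have left_mem : ∀ ω ω' : World V, ω ∈ mods (f ω ω') := fun ω ω' => by simp [hf]
  have right_mem : ∀ ω ω' : World V, ω' ∈ mods (f ω ω') := fun ω ω' => by simp [hf]
  obtain ⟨c, hcα, hc⟩ := hne
  rw [Set.mem_ofPred_eq] at hc
  have hgc : mods (g c) ⊆ mods α := by
    rw [hg]
    exact Set.singleton_subset_iff.2 hcα
  have hsub : modsOf ES (circ Ψ α) ⊆ mods α := by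
    obtain ⟨-, -, -, -, -, h6, -⟩ := h
    refine (mem_belief_iff ES _ α).1 (h6 Ψ (g c) α ?_ hgc)
    rw [mem_belief_iff, hc, hg]
  have hnon : (modsOf ES (circ Ψ α)).Nonempty := by
    obtain ⟨-, -, -, h4, -⟩ := h
    refine h4 Ψ (g c) α ?_ hgc
    exact ⟨c, hc.ge (Set.mem_singleton c)⟩
  ext ω
  constructor
  · refine fun hω => ⟨hsub hω, fun ω' hω' => ?_⟩
    have key : ω ∈ modsOf ES (circ Ψ (f ω ω')) ∨
        ω ∈ modsOf ES (circ Ψ (Form.and' α (Form.neg (f ω ω')))) := by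
      rcases h.modsOf_trichotomy Ψ (split (hsub hω) hω') with he | he | he
      · exact Or.inl (he ▸ hω)
      · exact Or.inr (he ▸ hω)
      · rwa [he] at hω
    refine key.elim id fun hr => ?_
    have hK : ω ∈ modsOf ES Ψ ∩ mods (f ω ω') :=
      ⟨outside (left_mem ω ω') hr, left_mem ω ω'⟩
    change ω ∈ modsOf ES (circ Ψ (f ω ω'))
    rwa [h.modsOf_eq_inter ⟨ω, hK⟩]
  · rintro ⟨hωα, hmin⟩
    obtain ⟨ω', hω'⟩ := hnon
    have hω'α := hsub hω'
    have hω : ω ∈ modsOf ES (circ Ψ (f ω ω')) := hmin ω' hω'α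
    rcases h.modsOf_trichotomy Ψ (split hωα hω'α) with he | he | he
    · rwa [he]
    · have hK : ω' ∈ modsOf ES Ψ := outside (right_mem ω ω') (he ▸ hω')
      rw [h.modsOf_eq_inter ⟨ω', hK, right_mem ω ω'⟩] at hω
      rw [h.modsOf_eq_inter ⟨ω', hK, hω'α⟩]
      exact ⟨hω.1, hωα⟩
    · rw [he]
      exact Or.inl hω

end CLR
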